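/- arXiv:1710.11494 — 2 statements merged into one kernel-verified Lean document; each statement's English description precedes it below -/
import Mathlib

section
/- For every real μ ≥ 0, the improper integral (1/√(2π)) ∫₀^∞ e^{it}·t^{-1/2+iμ} dt converges and equals (1/√(2π))·e^{iπ/4}·e^{-πμ/2}·Γ(1/2 + iμ); precisely, the function R ↦ ∫₀^R e^{it}·t^{-1/2+iμ} dt (an interval integral, the integrand being Lebesgue-integrable on (0,R)) tends to e^{iπ/4}·e^{-πμ/2}·Γ(1/2 + iμ) as R → ∞. -/
open MeasureTheory Set

open Filter Topology in
lemma aux_subst (μ : ℝ) (c : ℂ) (a b : ℝ) :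
    ∫ u in a..b, Complex.exp (c * Real.exp u + (1/2 + Complex.I * μ) * u) =
    ∫ t in Real.exp a..Real.exp b, Complex.exp (c * t) *
        Complex.exp ((-(1/2) + Complex.I * μ) * Real.log t) := by
  rw [← intervalIntegral.integral_deriv_smul_comp'' (f := Real.exp) (f' := Real.exp)]
  · refine intervalIntegral.integral_congr fun u _ => ?_
    simp only [Function.comp, Real.log_exp, Complex.real_smul, Complex.ofReal_exp]
    rw [← Complex.exp_add, ← Complex.exp_add]
    congr 1; ring
  · exact Real.continuous_exp.continuousOn
  · intro x _; exact (Real.hasDerivAt_exp x).hasDerivWithinAt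
  · exact Real.continuous_exp.continuousOn
  · rintro _ ⟨x, _, rfl⟩
    apply ContinuousAt.continuousWithinAt
    have h : ContinuousAt Real.log (Real.exp x) := Real.continuousAt_log (Real.exp_pos x).ne'
    have h2 : ContinuousAt (fun t : ℝ => (Real.log t : ℂ)) (Real.exp x) :=
      Complex.continuous_ofReal.continuousAt.comp h
    refine ContinuousAt.mul (by fun_prop) ?_
    exact Complex.continuous_exp.continuousAt.comp (continuousAt_const.mul h2)

lemma aux_int (μ : ℝ) (c : ℂ) (hc : c.re ≤ 0) (R : ℝ) (hR : 0 < R) :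
    IntegrableOn (fun t : ℝ => Complex.exp (c * t) *
        Complex.exp ((-(1/2) + Complex.I * μ) * Real.log t)) (Ioc 0 R) := by
  have h1 : IntegrableOn (fun t : ℝ => t ^ (-(1/2) : ℝ)) (Ioc 0 R) := by
    rw [← intervalIntegrable_iff_integrableOn_Ioc_of_le hR.le]
    exact intervalIntegral.intervalIntegrable_rpow' (by norm_num)
  refine Integrable.mono' h1 ?_ ?_
  · apply Measurable.aestronglyMeasurable
    fun_prop
  · refine (ae_restrict_iff' measurableSet_Ioc).2 (Filter.Eventually.of_forall fun t ht => ?_)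
    rw [norm_mul, Complex.norm_exp, Complex.norm_exp, Real.rpow_def_of_pos ht.1]
    have e1 : (c * t).re ≤ 0 := by
      simp only [Complex.mul_re, Complex.ofReal_re, Complex.ofReal_im, mul_zero, sub_zero]
      exact mul_nonpos_of_nonpos_of_nonneg hc ht.1.le
    have e2 : ((-(1/2) + Complex.I * μ) * Real.log t : ℂ).re = Real.log t * (-(1/2)) := by
      simp; ring
    rw [e2]
    have := Real.exp_le_one_iff.2 e1
    nlinarith [Real.exp_pos (Real.log t * (-(1/2)))]

/-- side contribution -/
noncomputable def auxE (μ : ℝ) (b : ℝ) : ℂ :=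
  ∫ y in (0:ℝ)..(Real.pi/2), Complex.exp (Complex.I * Complex.exp (b + y * Complex.I) +
    (1/2 + Complex.I * μ) * (b + y * Complex.I))

lemma aux_rect (μ : ℝ) (a b : ℝ) :
    (∫ t in Real.exp a..Real.exp b, Complex.exp (Complex.I * t) *
        Complex.exp ((-(1/2) + Complex.I * μ) * Real.log t)) =
    Complex.exp ((1/2 + Complex.I * μ) * (Real.pi / 2 * Complex.I)) *
    (∫ t in Real.exp a..Real.exp b, Complex.exp (-1 * t) *
        Complex.exp ((-(1/2) + Complex.I * μ) * Real.log t))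
    - Complex.I * auxE μ b + Complex.I * auxE μ a := by
  have H := Complex.integral_boundary_rect_eq_zero_of_differentiableOn
    (fun w => Complex.exp (Complex.I * Complex.exp w + (1/2 + Complex.I * μ) * w))
    (⟨a, 0⟩ : ℂ) (⟨b, Real.pi/2⟩ : ℂ) (by fun_prop)
  rw [← aux_subst, ← aux_subst, ← intervalIntegral.integral_const_mul]
  have e : ∀ x : ℝ, Complex.exp (Complex.I * Complex.exp (x + ((Real.pi/2 : ℝ):ℂ) * Complex.I) +
      (1/2 + Complex.I * μ) * (x + ((Real.pi/2 : ℝ):ℂ) * Complex.I)) =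
      Complex.exp ((1/2 + Complex.I * μ) * (Real.pi / 2 * Complex.I)) *
      Complex.exp (-1 * Real.exp x + (1/2 + Complex.I * μ) * x) := by
    intro x
    rw [← Complex.exp_add, Complex.exp_add x]
    push_cast
    rw [Complex.exp_pi_div_two_mul_I]
    congr 1
    linear_combination (Complex.exp x) * Complex.I_mul_I
  simp only [e] at H
  simp only [Complex.ofReal_zero, zero_mul, add_zero, smul_eq_mul] at H
  simp only [auxE, Complex.ofReal_exp] at H ⊢
  linear_combination H

lemma aux_norm (μ : ℝ) (hμ : 0 ≤ μ) (b y : ℝ) (hy : 0 ≤ y) (hy' : y ≤ Real.pi / 2) :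
    ‖Complex.exp (Complex.I * Complex.exp (b + y * Complex.I) +
    (1/2 + Complex.I * μ) * (b + y * Complex.I))‖ ≤
      Real.exp (b/2) * Real.exp (-(Real.exp b * (2 / Real.pi)) * y) := by
  rw [Complex.norm_exp, ← Real.exp_add]
  apply Real.exp_le_exp.2
  have e : (Complex.I * Complex.exp (b + y * Complex.I) +
    (1/2 + Complex.I * μ) * (b + y * Complex.I)).re = -(Real.exp b * Real.sin y) + b/2 - μ * y := by
    simp [Complex.exp_im]; ring
  rw [e]
  have h := Real.mul_le_sin hy hy'
  have := mul_le_mul_of_nonneg_left h (Real.exp_pos b).le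
  nlinarith [mul_nonneg hμ hy]

lemma aux_E1 (μ : ℝ) (hμ : 0 ≤ μ) (b : ℝ) : ‖auxE μ b‖ ≤ Real.exp (b/2) * (Real.pi / 2) := by
  have h := intervalIntegral.norm_integral_le_of_norm_le_const (a := 0) (b := Real.pi/2)
    (C := Real.exp (b/2)) (f := fun y : ℝ =>
      Complex.exp (Complex.I * Complex.exp (b + y * Complex.I) +
    (1/2 + Complex.I * μ) * (b + y * Complex.I))) (by
      intro y hy
      rw [uIoc_of_le (by positivity)] at hy
      refine (aux_norm μ hμ b y hy.1.le hy.2).trans ?_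
      refine mul_le_of_le_one_right (Real.exp_pos _).le (Real.exp_le_one_iff.2 ?_)
      have := hy.1.le
      rw [neg_mul]
      exact neg_nonpos.2 (by positivity))
  rwa [sub_zero, abs_of_nonneg (by positivity)] at h

lemma aux_E2 (μ : ℝ) (hμ : 0 ≤ μ) (b : ℝ) : ‖auxE μ b‖ ≤ Real.exp (-b/2) * (Real.pi / 2) := by
  have hp := Real.pi_pos
  have h := intervalIntegral.norm_integral_le_of_norm_le (a := 0) (b := Real.pi/2)
    (μ := volume)
    (g := fun y => Real.exp (b/2) * Real.exp (-(Real.exp b * (2 / Real.pi)) * y))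
    (f := fun y : ℝ =>
      Complex.exp (Complex.I * Complex.exp (b + y * Complex.I) +
    (1/2 + Complex.I * μ) * (b + y * Complex.I))) (by positivity)
    (Filter.Eventually.of_forall fun y hy => aux_norm μ hμ b y hy.1.le hy.2)
    (Continuous.intervalIntegrable (by fun_prop) _ _)
  refine h.trans ?_
  have hk : 0 < Real.exp b * (2 / Real.pi) := by positivity
  have hk' : -(Real.exp b * (2 / Real.pi)) ≠ 0 := by linarith
  rw [intervalIntegral.integral_const_mul, intervalIntegral.integral_comp_mul_left _ hk',
    integral_exp]
  have e : Real.exp (-b/2) * (Real.pi / 2) = Real.exp (b/2) * (Real.exp b * (2 / Real.pi))⁻¹ := by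
    have : Real.exp (-b/2) = Real.exp (b/2) * (Real.exp b)⁻¹ := by
      rw [← Real.exp_neg, ← Real.exp_add]; congr 1; ring
    rw [this]; field_simp
  rw [e]
  refine mul_le_mul_of_nonneg_left ?_ (Real.exp_pos _).le
  rw [smul_eq_mul, mul_zero, Real.exp_zero, inv_neg]
  have := Real.exp_pos (-(Real.exp b * (2 / Real.pi)) * (Real.pi/2))
  nlinarith [inv_pos.2 hk]

lemma aux_zero (f : ℝ → ℂ) (R : ℝ) (hR : 0 < R) (hf : IntegrableOn f (Ioc 0 R)) :
    Filter.Tendsto (fun a => ∫ t in Real.exp a..R, f t) Filter.atBot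
      (nhds (∫ t in (0:ℝ)..R, f t)) := by
  have h := intervalIntegral.continuousOn_primitive_interval_left (f := f) (a := 0) (b := R)
    (μ := volume) (by rw [uIcc_of_le hR.le]; rw [integrableOn_Icc_iff_integrableOn_Ioc]; exact hf)
  have h0 := h 0 left_mem_uIcc
  refine h0.tendsto.comp ?_
  refine tendsto_nhdsWithin_iff.2 ⟨Real.tendsto_exp_atBot, ?_⟩
  filter_upwards [Filter.eventually_le_atBot (Real.log R)] with a ha
  rw [uIcc_of_le hR.le]
  exact ⟨(Real.exp_pos a).le, (Real.le_log_iff_exp_le hR).1 ha⟩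

lemma aux_eq (μ : ℝ) (hμ : 0 ≤ μ) (b : ℝ) :
    (∫ t in (0:ℝ)..Real.exp b, Complex.exp (Complex.I * t) *
        Complex.exp ((-(1/2) + Complex.I * μ) * Real.log t)) =
    Complex.exp ((1/2 + Complex.I * μ) * (Real.pi / 2 * Complex.I)) *
    (∫ t in (0:ℝ)..Real.exp b, Complex.exp (-1 * t) *
        Complex.exp ((-(1/2) + Complex.I * μ) * Real.log t))
    - Complex.I * auxE μ b := by
  have h1 := aux_zero _ _ (Real.exp_pos b) (aux_int μ Complex.I (by simp) _ (Real.exp_pos b))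
  have h2 := aux_zero _ _ (Real.exp_pos b) (aux_int μ (-1) (by simp) _ (Real.exp_pos b))
  have h3 : Filter.Tendsto (fun a => auxE μ a) Filter.atBot (nhds 0) := by
    refine squeeze_zero_norm (aux_E1 μ hμ) ?_
    have : Filter.Tendsto (fun a : ℝ => Real.exp (a/2)) Filter.atBot (nhds 0) :=
      Real.tendsto_exp_atBot.comp (Filter.tendsto_id.atBot_div_const (by norm_num))
    simpa using this.mul_const (Real.pi/2)
  have h4 := ((h2.const_mul (Complex.exp ((1/2 + Complex.I * μ) *
    (Real.pi / 2 * Complex.I)))).sub_const (Complex.I * auxE μ b)).add (h3.const_mul Complex.I)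
  rw [mul_zero, add_zero] at h4
  refine tendsto_nhds_unique h1 (h4.congr fun a => ?_)
  exact (aux_rect μ a b).symm

lemma aux_gamma (μ : ℝ) : Filter.Tendsto (fun R : ℝ => ∫ t in (0:ℝ)..R, Complex.exp (-1 * t) *
        Complex.exp ((-(1/2) + Complex.I * μ) * Real.log t)) Filter.atTop
    (nhds (Complex.Gamma (1/2 + Complex.I * μ))) := by
  have hs : 0 < (1/2 + Complex.I * μ : ℂ).re := by simp
  rw [Complex.Gamma_eq_integral hs]
  refine (Complex.tendsto_partialGamma hs).congr' ?_
  filter_upwards [Filter.eventually_gt_atTop 0] with R hR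
  refine intervalIntegral.integral_congr_ae (Filter.Eventually.of_forall fun t ht => ?_)
  rw [uIoc_of_le hR.le] at ht
  rw [Complex.cpow_def_of_ne_zero (by exact_mod_cast ht.1.ne'), ← Complex.ofReal_log ht.1.le]
  push_cast
  congr 2
  · ring
  · ring

/-- For `μ ≥ 0`, the improper integral `∫₀^∞ e^{it} t^{-1/2+iμ} dt`
converges (as limit of `∫₀^R` as `R → ∞`, the integrand being Lebesgue integrable on
`(0,R)` for each `R > 0`), and its value is `e^{iπ/4} e^{-πμ/2} Γ(1/2 + iμ)`. -/
theorem improper_integral_gamma (μ : ℝ) (hμ : 0 ≤ μ) :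
    (∀ R : ℝ, 0 < R → IntegrableOn
      (fun t : ℝ => Complex.exp (Complex.I * t) *
        Complex.exp ((-(1/2) + Complex.I * μ) * Real.log t)) (Ioc 0 R)) ∧
    Filter.Tendsto
      (fun R : ℝ => ∫ t in Ioc (0:ℝ) R,
        Complex.exp (Complex.I * t) * Complex.exp ((-(1/2) + Complex.I * μ) * Real.log t))
      Filter.atTop
      (nhds (Complex.exp (Complex.I * Real.pi / 4) * Complex.exp (-(Real.pi * μ) / 2) *
        Complex.Gamma (1/2 + Complex.I * μ))) := by
  refine ⟨fun R hR => aux_int μ Complex.I (by simp) R hR, ?_⟩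
  have h3 : Filter.Tendsto (fun b => auxE μ b) Filter.atTop (nhds 0) := by
    refine squeeze_zero_norm (aux_E2 μ hμ) ?_
    have : Filter.Tendsto (fun a : ℝ => Real.exp (-a/2)) Filter.atTop (nhds 0) :=
      Real.tendsto_exp_atBot.comp
        (Filter.tendsto_neg_atTop_atBot.atBot_div_const (by norm_num))
    simpa using this.mul_const (Real.pi/2)
  have h4 := ((aux_gamma μ).const_mul (Complex.exp ((1/2 + Complex.I * μ) *
    (Real.pi / 2 * Complex.I)))).sub ((h3.comp Real.tendsto_log_atTop).const_mul Complex.I)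
  have e : Complex.exp ((1/2 + Complex.I * μ) * (Real.pi / 2 * Complex.I)) =
      Complex.exp (Complex.I * Real.pi / 4) * Complex.exp (-(Real.pi * μ) / 2) := by
    rw [← Complex.exp_add]; congr 1
    linear_combination (μ * Real.pi / 2 : ℂ) * Complex.I_mul_I
  rw [mul_zero, sub_zero, e] at h4
  refine h4.congr' ?_
  filter_upwards [Filter.eventually_gt_atTop 0] with R hR
  rw [← intervalIntegral.integral_of_le hR.le]
  have := aux_eq μ hμ (Real.log R)
  rw [Real.exp_log hR, e] at this
  exact this.symm
end

section
/- Let ζ be a point of the segment [−e^{iπ/4}/√2, e^{iπ/4}/√2] in ℂ, and let z = ζ + s·e^{3iπ/4} for some real s (so that z lies on the normal line to this segment at ζ). Then dist(z², [0, i/2]) = 2|ζ|·|z − ζ| whenever |z − ζ| ≤ |ζ|, and dist(z², [0, i/2]) = |ζ|² + |z − ζ|² = |z|² whenever |z − ζ| ≥ |ζ|. -/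
open Set

lemma infDist_aux (w : ℂ) (d τ₀ : ℝ) (hd : 0 ≤ d) (h0 : 0 ≤ τ₀) (h1 : τ₀ ≤ 1)
    (he : w.re ^ 2 + (w.im - τ₀ / 2) ^ 2 = d ^ 2)
    (hle : ∀ τ : ℝ, 0 ≤ τ → τ ≤ 1 → d ^ 2 ≤ w.re ^ 2 + (w.im - τ / 2) ^ 2) :
    Metric.infDist w (segment ℝ 0 (Complex.I / 2)) = d := by
  have key : ∀ τ : ℝ, dist w (τ • (Complex.I / 2)) ^ 2 = w.re ^ 2 + (w.im - τ / 2) ^ 2 := by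
    intro τ
    rw [dist_eq_norm, Complex.sq_norm, Complex.normSq_apply]
    have h3 : (w - τ • (Complex.I / 2)).re = w.re := by simp
    have h4 : (w - τ • (Complex.I / 2)).im = w.im - τ / 2 := by simp; ring
    rw [h3, h4]; ring
  have hmem : ∀ τ : ℝ, 0 ≤ τ → τ ≤ 1 → τ • (Complex.I / 2) ∈ segment ℝ 0 (Complex.I / 2) := by
    intro τ a b
    exact ⟨1 - τ, τ, by linarith, a, by ring, by simp⟩
  apply le_antisymm
  · refine (Metric.infDist_le_dist_of_mem (hmem τ₀ h0 h1)).trans ?_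
    apply le_of_eq
    rw [← sq_eq_sq₀ dist_nonneg hd, key, he]
  · rw [Metric.le_infDist ⟨_, hmem τ₀ h0 h1⟩]
    rintro y ⟨a, b, ha, hb, hab, rfl⟩
    rw [smul_zero, zero_add]
    refine (abs_le_of_sq_le_sq' ?_ dist_nonneg).2
    rw [key]
    exact hle b hb (by linarith)

/-- Let `ζ` lie on the segment `[−e^{iπ/4}/√2, e^{iπ/4}/√2]` and let
`z = ζ + s·e^{3iπ/4}` with `s` real (so `z` lies on the normal to the segment at `ζ`). Then
`dist(z², [0, i/2]) = 2|ζ||z−ζ|` if `|z−ζ| ≤ |ζ|`, and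
`dist(z², [0, i/2]) = |ζ|² + |z−ζ|² = |z|²` if `|z−ζ| ≥ |ζ|`. -/
theorem dist_sq_on_normal (ζ : ℂ)
    (hζ : ζ ∈ segment ℝ (-(Complex.exp (Complex.I * Real.pi / 4) / (Real.sqrt 2 : ℂ)))
      (Complex.exp (Complex.I * Real.pi / 4) / (Real.sqrt 2 : ℂ)))
    (s : ℝ) (z : ℂ) (hz : z = ζ + s * Complex.exp (3 * Real.pi * Complex.I / 4)) :
    (‖z - ζ‖ ≤ ‖ζ‖ →
      Metric.infDist (z ^ 2) (segment ℝ 0 (Complex.I / 2)) = 2 * ‖ζ‖ * ‖z - ζ‖) ∧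
    (‖ζ‖ ≤ ‖z - ζ‖ →
      Metric.infDist (z ^ 2) (segment ℝ 0 (Complex.I / 2)) = ‖ζ‖ ^ 2 + ‖z - ζ‖ ^ 2 ∧
      ‖ζ‖ ^ 2 + ‖z - ζ‖ ^ 2 = ‖z‖ ^ 2) := by
  obtain ⟨c, hc⟩ : ∃ c : ℝ, c = √2 / 2 := ⟨_, rfl⟩
  have h2 : √2 ^ 2 = 2 := Real.sq_sqrt (by norm_num)
  have hc2 : c ^ 2 = 1 / 2 := by rw [hc, div_pow, h2]; norm_num
  have hcpos : 0 < c := by rw [hc]; positivity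
  have e1 : Complex.exp (Complex.I * Real.pi / 4) = ⟨c, c⟩ := by
    have : Complex.I * Real.pi / 4 = ((Real.pi / 4 : ℝ) : ℂ) * Complex.I := by push_cast; ring
    rw [this]
    apply Complex.ext
    · rw [Complex.exp_ofReal_mul_I_re, Real.cos_pi_div_four, hc]
    · rw [Complex.exp_ofReal_mul_I_im, Real.sin_pi_div_four, hc]
  have e3 : Complex.exp (3 * Real.pi * Complex.I / 4) = ⟨-c, c⟩ := by
    have : 3 * Real.pi * Complex.I / 4 = ((Real.pi - Real.pi / 4 : ℝ) : ℂ) * Complex.I := by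
      push_cast; ring
    rw [this]
    apply Complex.ext
    · rw [Complex.exp_ofReal_mul_I_re, Real.cos_pi_sub, Real.cos_pi_div_four, hc]
    · rw [Complex.exp_ofReal_mul_I_im, Real.sin_pi_sub, Real.sin_pi_div_four, hc]
  rw [e1] at hζ
  rw [e3] at hz
  obtain ⟨r, hr, hζr⟩ : ∃ r : ℝ, r ^ 2 ≤ 1 / 2 ∧ ζ = ⟨r * c, r * c⟩ := by
    obtain ⟨a, b, ha, hb, hab, rfl⟩ := hζ
    refine ⟨(b - a) / √2, ?_, ?_⟩
    · rw [div_pow, h2]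
      have : (b - a) ^ 2 ≤ 1 := by nlinarith [mul_nonneg ha hb]
      linarith
    · apply Complex.ext
      · simp [Complex.div_ofReal_re]; ring
      · simp [Complex.div_ofReal_im]; ring
  have nζ : ‖ζ‖ = |r| := by
    rw [← sq_eq_sq₀ (norm_nonneg _) (abs_nonneg _), Complex.sq_norm, sq_abs, hζr,
      Complex.normSq_mk]
    linear_combination 2 * r ^ 2 * hc2
  have nz : ‖z - ζ‖ = |s| := by
    rw [← sq_eq_sq₀ (norm_nonneg _) (abs_nonneg _), Complex.sq_norm, sq_abs, hz,
      add_sub_cancel_left, Complex.normSq_mul, Complex.normSq_ofReal, Complex.normSq_mk]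
    linear_combination 2 * s ^ 2 * hc2
  have zre : z.re = (r - s) * c := by rw [hz, hζr]; simp; ring
  have zim : z.im = (r + s) * c := by rw [hz, hζr]; simp; ring
  have wre : (z ^ 2).re = -2 * r * s := by
    rw [sq, Complex.mul_re, zre, zim]; linear_combination (-4 * r * s) * hc2
  have wim : (z ^ 2).im = r ^ 2 - s ^ 2 := by
    rw [sq, Complex.mul_im, zre, zim]; linear_combination (2 * (r ^ 2 - s ^ 2)) * hc2
  rw [nζ, nz]
  refine ⟨fun h => ?_, fun h => ⟨?_, ?_⟩⟩
  · have h' := sq_le_sq.mpr h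
    have hd : (2 * |r| * |s|) ^ 2 = 4 * r ^ 2 * s ^ 2 := by
      rw [mul_pow, mul_pow, sq_abs, sq_abs]; ring
    apply infDist_aux _ _ (2 * (r ^ 2 - s ^ 2)) (by positivity) (by linarith)
      (by nlinarith [sq_nonneg s])
    · rw [wre, wim, hd]; ring
    · intro τ _ _
      rw [wre, wim, hd]; nlinarith [sq_nonneg (r ^ 2 - s ^ 2 - τ / 2)]
  · have h' := sq_le_sq.mpr h
    rw [sq_abs, sq_abs]
    apply infDist_aux _ _ 0 (by positivity) le_rfl zero_le_one
    · rw [wre, wim]; ring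
    · intro τ h0 _
      rw [wre, wim]; nlinarith [mul_nonneg h0 (sub_nonneg.2 h'), sq_nonneg τ]
  · rw [sq_abs, sq_abs, Complex.sq_norm, Complex.normSq_apply, zre, zim]
    linear_combination (-2 * (r ^ 2 + s ^ 2)) * hc2
end
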